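/- For every sequential weighted automaton A = (A,X,Y,σ^A,μ^A) over a semiring S there exists a Moore-type weighted automaton B = (B,X,Y,σ^B,δ^B,ω^B) over S such that ⟦A⟧ = ⟦B⟧_{1n}, i.e. the behavior of A equals the 1n-behavior of B as functions (X×Y)* → S. Moreover, B can be chosen with |B| ≤ |A|·|Y|. (Concretely, B = A×Y with a fixed y₀ ∈ Y, σ^B(a,y₀) = σ^A(a) and σ^B(a,y) = 0 for y ≠ y₀, δ^B((a₁,y₁),x,(a₂,y₂)) = μ^A(a₁,x,y₂,a₂), and ω^B((a,y'),y) = 1 if y' = y and 0 otherwise, works.) -/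

import Mathlib

noncomputable section

open Finset

/-- A sequential weighted automaton over a semiring `S`. -/
structure SeqWA (S A X Y : Type) where
  σ : A → S
  μ : A → X → Y → A → S

/-- A Mealy-type weighted automaton over a semiring `S`. -/
structure MealyWA (S A X Y : Type) where
  σ : A → S
  δ : A → X → A → S
  ω : A → X → Y → S

/-- A Moore-type weighted automaton over a semiring `S`. -/
structure MooreWA (S A X Y : Type) where
  σ : A → S
  δ : A → X → A → S
  ω : A → Y → S

variable {S A X Y : Type} [Semiring S] [Fintype A] [DecidableEq A]

/-- extension of letterwise matrices to words: `μ_ε = 1`, `μ_{wx} = μ_w * μ_x`. -/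
def wordMat {P : Type} (μ : P → Matrix A A S) (w : List P) : Matrix A A S :=
  w.foldl (fun m p => m * μ p) 1

def SeqWA.mat (M : SeqWA S A X Y) (p : X × Y) : Matrix A A S :=
  Matrix.of fun a b => M.μ a p.1 p.2 b

/-- behavior of a sequential weighted automaton. -/
def SeqWA.beh (M : SeqWA S A X Y) (w : List (X × Y)) : S :=
  ∑ a, ∑ b, M.σ a * wordMat M.mat w a b

def MealyWA.δmat (M : MealyWA S A X Y) (x : X) : Matrix A A S :=
  Matrix.of fun a b => M.δ a x b

def MealyWA.ωvec (M : MealyWA S A X Y) (p : X × Y) : A → S :=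
  fun a => M.ω a p.1 p.2

/-- 1n-semantics vectors for a Mealy automaton:
`ω_{ε,ε} = 1`, `ω_{x,y}` as given, and `ω_{xu,yv} = D(ω_{x,y})·δ_x·ω_{u,v}`. -/
def MealyWA.omega1n (M : MealyWA S A X Y) : List (X × Y) → A → S
  | [] => fun _ => 1
  | [p] => fun a => M.ω a p.1 p.2
  | p :: q :: w => fun a => M.ω a p.1 p.2 * ∑ b, M.δ a p.1 b * M.omega1n (q :: w) b

/-- 1n-behavior of a Mealy automaton. -/
def MealyWA.beh1n (M : MealyWA S A X Y) (w : List (X × Y)) : S :=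
  ∑ a, M.σ a * M.omega1n w a

/-- n1-semantics data for a Mealy automaton: the pair `(ω_{u,v}, δ_u)` computed by
`ω_{ε,ε} = 1`, `δ_ε = 1`, `ω_{ux,vy} = D(ω_{u,v})·δ_u·ω_{x,y}` and `δ_{ux} = δ_u·δ_x`. -/
def MealyWA.n1aux (M : MealyWA S A X Y) (w : List (X × Y)) : (A → S) × Matrix A A S :=
  w.foldl (fun st p => (fun a => st.1 a * ∑ b, st.2 a b * M.ω b p.1 p.2, st.2 * M.δmat p.1))
    (fun _ => 1, 1)

/-- n1-behavior of a Mealy automaton. -/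
def MealyWA.behN1 (M : MealyWA S A X Y) (w : List (X × Y)) : S :=
  ∑ a, M.σ a * (M.n1aux w).1 a

/-- the nested sums occurring in the sequential semantics of a Mealy automaton. -/
def MealyWA.sAux (M : MealyWA S A X Y) : List (X × Y) → A → S
  | [] => fun _ => 1
  | p :: w => fun a => M.ω a p.1 p.2 * ∑ b, M.δ a p.1 b * M.sAux w b

/-- s-behavior (sequential semantics) of a Mealy automaton. -/
def MealyWA.behS (M : MealyWA S A X Y) (w : List (X × Y)) : S :=
  ∑ a, M.σ a * M.sAux w a

def MooreWA.δmat (M : MooreWA S A X Y) (x : X) : Matrix A A S :=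
  Matrix.of fun a b => M.δ a x b

/-- 1n-semantics vectors for a Moore automaton:
`ω_{ε,ε} = 1` and `ω_{xu,yv} = δ_x·D(ω_y)·ω_{u,v}`. -/
def MooreWA.omega1n (M : MooreWA S A X Y) : List (X × Y) → A → S
  | [] => fun _ => 1
  | p :: w => fun a => ∑ b, M.δ a p.1 b * (M.ω b p.2 * M.omega1n w b)

/-- 1n-behavior of a Moore automaton. -/
def MooreWA.beh1n (M : MooreWA S A X Y) (w : List (X × Y)) : S :=
  ∑ a, M.σ a * M.omega1n w a

/-- n1-semantics data for a Moore automaton: the pair `(ω_{u,v}, δ_u)` computed by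
`ω_{ε,ε} = 1`, `δ_ε = 1`, `ω_{ux,vy} = D(ω_{u,v})·δ_{ux}·ω_y` and `δ_{ux} = δ_u·δ_x`. -/
def MooreWA.n1aux (M : MooreWA S A X Y) (w : List (X × Y)) : (A → S) × Matrix A A S :=
  w.foldl (fun st p =>
      (fun a => st.1 a * ∑ b, (st.2 * M.δmat p.1) a b * M.ω b p.2, st.2 * M.δmat p.1))
    (fun _ => 1, 1)

/-- n1-behavior of a Moore automaton. -/
def MooreWA.behN1 (M : MooreWA S A X Y) (w : List (X × Y)) : S :=
  ∑ a, M.σ a * (M.n1aux w).1 a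

theorem wordMat_cons {P : Type} (μ : P → Matrix A A S) (p : P) (w : List P) :
    wordMat μ (p :: w) = μ p * wordMat μ w := by
  have h : ∀ (w : List P) (m : Matrix A A S),
      w.foldl (fun m p => m * μ p) m = m * wordMat μ w := by
    intro w
    induction w with
    | nil => intro m; simp [wordMat]
    | cons q w ih =>
      intro m
      simp only [wordMat, List.foldl_cons, one_mul] at ih ⊢
      rw [ih (m * μ q), ih (μ q), Matrix.mul_assoc]
  simp only [wordMat, List.foldl_cons, one_mul]
  exact h w (μ p)

/-- The Moore-type automaton on `A × Y` which remembers the last emitted output letter. -/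
def SeqWA.toMoore [DecidableEq Y] (M : SeqWA S A X Y) (y₀ : Y) : MooreWA S (A × Y) X Y where
  σ b := if b.2 = y₀ then M.σ b.1 else 0
  δ b x c := M.μ b.1 x c.2 c.1
  ω b y := if b.2 = y then 1 else 0

theorem SeqWA.omega1n_toMoore [Fintype Y] [DecidableEq Y] (M : SeqWA S A X Y) (y₀ : Y)
    (w : List (X × Y)) (b : A × Y) :
    (M.toMoore y₀).omega1n w b = ∑ c, wordMat M.mat w b.1 c := by
  induction w generalizing b with
  | nil => simp [MooreWA.omega1n, wordMat, Matrix.one_apply]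
  | cons p w ih =>
    simp only [MooreWA.omega1n, ih, wordMat_cons, Matrix.mul_apply]
    rw [Finset.sum_comm, Fintype.sum_prod_type]
    simp [SeqWA.toMoore, SeqWA.mat, Finset.mul_sum]

theorem SeqWA.beh1n_toMoore [Fintype Y] [DecidableEq Y] (M : SeqWA S A X Y) (y₀ : Y) :
    (M.toMoore y₀).beh1n = M.beh := by
  funext w
  simp only [MooreWA.beh1n, SeqWA.beh, M.omega1n_toMoore, Fintype.sum_prod_type]
  simp [SeqWA.toMoore, Finset.mul_sum]

/-- every sequential weighted automaton is equivalent (its behavior vs. the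
1n-behavior) to a Moore-type weighted automaton with at most `|A|·|Y|` states. -/
theorem stmt5 {S A X Y : Type} [Semiring S] [Fintype A] [DecidableEq A] [Nonempty A]
    [Fintype X] [Nonempty X] [Fintype Y] [Nonempty Y]
    (M : SeqWA S A X Y) :
    ∃ (B : Type) (_ : Fintype B) (_ : DecidableEq B) (_ : Nonempty B)
      (N : MooreWA S B X Y), M.beh = N.beh1n ∧
        Fintype.card B ≤ Fintype.card A * Fintype.card Y := by
  classical
  obtain ⟨y₀⟩ := ‹Nonempty Y›
  exact ⟨A × Y, inferInstance, inferInstance, ⟨(Classical.arbitrary A, y₀)⟩, M.toMoore y₀,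
    (M.beh1n_toMoore y₀).symm, (Fintype.card_prod A Y).le⟩
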